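/- arXiv:2211.09209 — 2 statements merged into one kernel-verified Lean document; each statement's English description precedes it below -/
import Mathlib

section
/- Let q be a real number with q ≠ 0, ±1 and let n ≥ 1. For every function f: ℝ → ℝ and every point x ∈ ℝ: the n-th Gaussian Riemann derivative _qD_n f(x) exists if and only if the n-th Gaussian Riemann derivative _{1/q}D_n f(x) exists, and in that case the two derivatives are equal. -/
open Filter Topology

noncomputable section

/-- Base-point multipliers `{0, 1, q, q², …, q^{n-1}}` of the `n`-th Gaussian Riemann
derivative `_qD_n`. -/
def gaussNodes (q : ℝ) (n : ℕ) (k : Fin (n + 1)) : ℝ :=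
  if k.val = 0 then 0 else q ^ (k.val - 1)

/-- The `n`-th Gaussian Riemann derivative `_qD_n f (x)` exists and equals `L`:
for the (unique) coefficient vector `A` making the data based at
`x, x+h, x+qh, …, x+q^{n-1}h` satisfy the `n`-th Vandermonde relations, the defining
limit exists and equals `L`. -/
def QGaussDerivAt (q : ℝ) (n : ℕ) (f : ℝ → ℝ) (x L : ℝ) : Prop :=
  ∃ A : Fin (n + 1) → ℝ, (∀ k, A k ≠ 0) ∧
    (∀ j ≤ n, ∑ k, A k * gaussNodes q n k ^ j =
      if j = n then (Nat.factorial n : ℝ) else 0) ∧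
    Tendsto (fun h : ℝ => (∑ k, A k * f (x + gaussNodes q n k * h)) / h ^ n)
      (𝓝[≠] (0 : ℝ)) (𝓝 L)

/-- Inverting `q` dilates the Gaussian nodes by `q^{-(n-1)}` and reverses the nonzero ones. -/
lemma gaussNodes_inv {q : ℝ} (hq : q ≠ 0) (n : ℕ) (k : Fin (n + 1)) :
    gaussNodes q⁻¹ n k = (q ^ (n - 1))⁻¹ * gaussNodes q n (-k) := by
  rcases eq_or_ne k 0 with rfl | hk
  · simp [gaussNodes]
  · have hk' : k.val ≠ 0 := fun h => hk (Fin.ext h)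
    have hlt := k.isLt
    have hval : (-k).val = n + 1 - k.val := by
      rw [Fin.val_neg', Nat.mod_eq_of_lt (by omega)]
    have hneg : (-k).val ≠ 0 := by omega
    have hexp : n - 1 = (k.val - 1) + ((-k).val - 1) := by omega
    simp only [gaussNodes, if_neg hk', if_neg hneg]
    rw [hexp, pow_add, inv_pow]
    field_simp

lemma QGaussDerivAt.inv {q : ℝ} (hq : q ≠ 0) {n : ℕ} {f : ℝ → ℝ} {x L : ℝ}
    (hf : QGaussDerivAt q n f x L) : QGaussDerivAt q⁻¹ n f x L := by
  obtain ⟨A, hA, hV, hlim⟩ := hf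
  set c : ℝ := q ^ (n - 1) with hc
  have hc0 : c ≠ 0 := pow_ne_zero _ hq
  refine ⟨fun k => c ^ n * A (-k), fun k => mul_ne_zero (pow_ne_zero _ hc0) (hA _), ?_, ?_⟩
  · intro j hj
    have hsum : ∑ k, c ^ n * A (-k) * gaussNodes q⁻¹ n k ^ j =
        c ^ n * (c⁻¹) ^ j * ∑ k, A k * gaussNodes q n k ^ j := by
      rw [← Equiv.sum_comp (Equiv.neg (Fin (n + 1))) (fun k => A k * gaussNodes q n k ^ j),
        Finset.mul_sum]
      refine Finset.sum_congr rfl fun k _ => ?_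
      rw [gaussNodes_inv hq, mul_pow, Equiv.neg_apply]
      ring
    rw [hsum, hV j hj]
    split_ifs with h
    · rw [h, ← mul_pow, mul_inv_cancel₀ hc0, one_pow, one_mul]
    · rw [mul_zero]
  · have hdil : Tendsto (fun h : ℝ => c⁻¹ * h) (𝓝[≠] 0) (𝓝[≠] 0) := by
      refine tendsto_nhdsWithin_iff.2 ⟨?_, ?_⟩
      · have : Tendsto (fun h : ℝ => c⁻¹ * h) (𝓝 0) (𝓝 (c⁻¹ * 0)) :=
          tendsto_id.const_mul _
        rw [mul_zero] at this
        exact this.mono_left nhdsWithin_le_nhds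
      · filter_upwards [self_mem_nhdsWithin] with h hh
        exact mul_ne_zero (inv_ne_zero hc0) hh
    refine (hlim.comp hdil).congr fun h => ?_
    have hsum : ∑ k, c ^ n * A (-k) * f (x + gaussNodes q⁻¹ n k * h) =
        c ^ n * ∑ k, A k * f (x + gaussNodes q n k * (c⁻¹ * h)) := by
      rw [← Equiv.sum_comp (Equiv.neg (Fin (n + 1)))
        (fun k => A k * f (x + gaussNodes q n k * (c⁻¹ * h))), Finset.mul_sum]
      refine Finset.sum_congr rfl fun k _ => ?_
      rw [gaussNodes_inv hq, Equiv.neg_apply, mul_assoc, ← hc,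
        show c⁻¹ * gaussNodes q n (-k) * h = gaussNodes q n (-k) * (c⁻¹ * h) by ring]
    rw [hsum, Function.comp_apply, mul_pow, inv_pow, mul_comm (c ^ n), mul_comm (c ^ n)⁻¹,
      div_mul_eq_div_div, div_inv_eq_mul, div_mul_eq_mul_div]

/-- For `q ≠ 0, ±1` and `n ≥ 1`: `_qD_n f(x)` exists iff `_{1/q}D_n f(x)` exists, and
in that case the two derivatives are equal (i.e. they exist with the same value `L`). -/
theorem qGaussDeriv_iff_inv_qGaussDeriv (q : ℝ) (hq0 : q ≠ 0) (hq1 : q ≠ 1) (hqm1 : q ≠ -1)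
    (n : ℕ) (hn : 1 ≤ n) (f : ℝ → ℝ) (x : ℝ) :
    ∀ L : ℝ, QGaussDerivAt q n f x L ↔ QGaussDerivAt (1 / q) n f x L := by
  intro L
  rw [one_div]
  refine ⟨fun h => h.inv hq0, fun h => ?_⟩
  simpa only [inv_inv] using h.inv (inv_ne_zero hq0)
end
end

section
/- Let n = 3 or n = 4, and let A = {A_0,…,A_n; a_0,…,a_n} be data for an n-th generalized Riemann derivative without excess which is symmetric, i.e. the set of multipliers {a_0,…,a_n} is symmetric about 0. Then there exists a real number q' with q' ≠ 0, ±1 such that for every function f: ℝ → ℝ and every point x: D_A f(x) exists if and only if the n-th symmetric Gaussian Riemann derivative _{q'}D^s_n f(x) exists, and in that case the two are equal. -/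
open Filter Topology

noncomputable section

/-- Base-point multipliers `{±1, ±q, …, ±q^{m-1}}`, together with `0` when `n` is even
(where `m = ⌊(n+1)/2⌋`), of the `n`-th symmetric Gaussian Riemann derivative `_qD^s_n`. -/
def symGaussNodes (q : ℝ) (n : ℕ) (k : Fin (n + 1)) : ℝ :=
  if k.val < (n + 1) / 2 then q ^ k.val
  else if k.val < 2 * ((n + 1) / 2) then -q ^ (k.val - (n + 1) / 2)
  else 0

/-- The `n`-th symmetric Gaussian Riemann derivative `_qD^s_n f (x)` exists and equals `L`. -/
def QSymGaussDerivAt (q : ℝ) (n : ℕ) (f : ℝ → ℝ) (x L : ℝ) : Prop :=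
  ∃ A : Fin (n + 1) → ℝ, (∀ k, A k ≠ 0) ∧
    (∀ j ≤ n, ∑ k, A k * symGaussNodes q n k ^ j =
      if j = n then (Nat.factorial n : ℝ) else 0) ∧
    Tendsto (fun h : ℝ => (∑ k, A k * f (x + symGaussNodes q n k * h)) / h ^ n)
      (𝓝[≠] (0 : ℝ)) (𝓝 L)

/-- The weights of a generalized Riemann derivative without excess are determined by its nodes. -/
theorem weights_unique {n : ℕ} {b B C : Fin (n + 1) → ℝ} (hb : Function.Injective b)
    (h : ∀ j ≤ n, ∑ k, B k * b k ^ j = ∑ k, C k * b k ^ j) : B = C := by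
  rw [← sub_eq_zero]
  refine Matrix.eq_zero_of_forall_pow_sum_mul_pow_eq_zero hb fun j => ?_
  simpa [sub_mul, Finset.sum_sub_distrib, sub_eq_zero] using h j (Nat.lt_succ_iff.mp j.isLt)

/-- Rescaling by a nonzero constant preserves the punctured neighborhood filter of `0`. -/
theorem tendsto_const_mul_punctured {c : ℝ} (hc : c ≠ 0) :
    Tendsto (fun h : ℝ => c * h) (𝓝[≠] 0) (𝓝[≠] 0) := by
  refine tendsto_nhdsWithin_iff.mpr ⟨?_, ?_⟩
  · have h : Tendsto (fun h : ℝ => c * h) (𝓝 0) (𝓝 (c * 0)) :=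
      (continuous_const_mul c).tendsto 0
    rw [mul_zero] at h
    exact h.mono_left nhdsWithin_le_nhds
  · filter_upwards [self_mem_nhdsWithin] with h hh
    exact mul_ne_zero hc hh

/-- Limits along the punctured neighborhoods of `0` are invariant under nonzero dilations. -/
theorem tendsto_comp_const_mul_punctured_iff {c : ℝ} (hc : c ≠ 0) (g : ℝ → ℝ) (L : ℝ) :
    Tendsto (fun h => g (c * h)) (𝓝[≠] 0) (𝓝 L) ↔ Tendsto g (𝓝[≠] 0) (𝓝 L) := by
  refine ⟨fun h => ?_, fun h => h.comp (tendsto_const_mul_punctured hc)⟩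
  simpa [Function.comp_def, mul_inv_cancel_left₀ hc] using
    h.comp (tendsto_const_mul_punctured (inv_ne_zero hc))

/-- If the nodes of a generalized Riemann derivative without excess are a dilate of the symmetric
Gaussian nodes, then the two derivatives coincide. -/
theorem tendsto_iff_qSymGaussDerivAt {n : ℕ} {A a : Fin (n + 1) → ℝ} {c q : ℝ} (hc : c ≠ 0)
    (hA : ∀ k, A k ≠ 0) (ha : Function.Injective a)
    (hV : ∀ j ≤ n, ∑ k, A k * a k ^ j = if j = n then (Nat.factorial n : ℝ) else 0)
    (hnodes : ∀ k, ∃ j, a k = c * symGaussNodes q n j) (f : ℝ → ℝ) (x L : ℝ) :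
    Tendsto (fun h : ℝ => (∑ k, A k * f (x + a k * h)) / h ^ n) (𝓝[≠] (0 : ℝ)) (𝓝 L) ↔
      QSymGaussDerivAt q n f x L := by
  choose g hg using hnodes
  have hg_inj : Function.Injective g := fun i j hij => ha (by rw [hg, hg, hij])
  let e : Fin (n + 1) ≃ Fin (n + 1) :=
    Equiv.ofBijective g (Finite.injective_iff_bijective.mp hg_inj)
  have he : ∀ k, a k = c * symGaussNodes q n (e k) := hg
  have hnodes_inj : Function.Injective (symGaussNodes q n) := fun i j hij => by
    have h : a (e.symm i) = a (e.symm j) := by simp [he, hij]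
    exact e.symm.injective (ha h)
  let B : Fin (n + 1) → ℝ := fun j => c ^ n * A (e.symm j)
  have hB : ∀ j ≤ n, ∑ k, B k * symGaussNodes q n k ^ j =
      if j = n then (Nat.factorial n : ℝ) else 0 := by
    intro j hj
    have hscale : c ^ j * ∑ k, B k * symGaussNodes q n k ^ j =
        c ^ n * ∑ k, A k * a k ^ j := by
      rw [← e.sum_comp, Finset.mul_sum, Finset.mul_sum]
      refine Finset.sum_congr rfl fun k _ => ?_
      simp only [B, Equiv.symm_apply_apply, he k, mul_pow]
      ring
    rw [hV j hj] at hscale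
    apply mul_left_cancel₀ (pow_ne_zero j hc)
    rw [hscale]
    split_ifs with h
    · rw [h]
    · simp
  let G : ℝ → ℝ := fun t => (∑ k, B k * f (x + symGaussNodes q n k * t)) / t ^ n
  have hquot : (fun h : ℝ => (∑ k, A k * f (x + a k * h)) / h ^ n) =
      fun h => G (c * h) := by
    funext h
    have hsum : ∑ k, B k * f (x + symGaussNodes q n k * (c * h)) =
        c ^ n * ∑ k, A k * f (x + a k * h) := by
      rw [← e.sum_comp, Finset.mul_sum]
      refine Finset.sum_congr rfl fun k _ => ?_
      simp only [B, Equiv.symm_apply_apply, he k]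
      rw [mul_assoc, mul_left_comm _ c, mul_assoc c]
    simp only [G]
    rw [hsum, mul_pow, mul_div_mul_left _ _ (pow_ne_zero n hc)]
  rw [hquot, tendsto_comp_const_mul_punctured_iff hc G]
  constructor
  · exact fun h => ⟨B, fun k => mul_ne_zero (pow_ne_zero n hc) (hA _), hB, h⟩
  · rintro ⟨C, -, hC, h⟩
    have hBC : B = C := weights_unique hnodes_inj fun j hj => by rw [hB j hj, hC j hj]
    simpa only [G, hBC] using h

/-- A finite set of nonzero reals that is symmetric about `0` has even cardinality. -/
theorem even_card_of_symmetric {T : Finset ℝ} (hT : ∀ t ∈ T, -t ∈ T) (h0 : (0 : ℝ) ∉ T) :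
    Even T.card := by
  rw [← ZMod.natCast_eq_zero_iff_even, Finset.cast_card]
  refine Finset.sum_involution (fun t _ => -t) (fun _ _ => by decide) (fun t ht _ h => ?_)
    hT (fun t _ => neg_neg t)
  have ht0 : t = 0 := by linarith
  exact h0 (ht0 ▸ ht)

/-- A four-element symmetric set of nonzero reals has the form `{±u, ±v}`. -/
theorem exists_pairs_of_symmetric {T : Finset ℝ} (hT : ∀ t ∈ T, -t ∈ T) (h0 : (0 : ℝ) ∉ T)
    (hcard : T.card = 4) :
    ∃ u v : ℝ, u ≠ 0 ∧ v ≠ 0 ∧ v ≠ u ∧ v ≠ -u ∧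
      ∀ t ∈ T, t = u ∨ t = v ∨ t = -u ∨ t = -v := by
  have hne : ∀ t ∈ T, t ≠ 0 := fun t ht h => h0 (h ▸ ht)
  obtain ⟨u, hu⟩ : T.Nonempty := Finset.card_pos.mp (by omega)
  obtain ⟨v, hv, hvu⟩ : ∃ v ∈ T, v ∉ ({u, -u} : Finset ℝ) :=
    Finset.exists_mem_notMem_of_card_lt_card (Finset.card_le_two.trans_lt (by omega))
  simp only [Finset.mem_insert, Finset.mem_singleton, not_or] at hvu
  have hu0 := hne u hu
  have hv0 := hne v hv
  refine ⟨u, v, hu0, hv0, hvu.1, hvu.2, ?_⟩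
  have hsub : ({u, v, -u, -v} : Finset ℝ) ⊆ T := by
    simp [Finset.insert_subset_iff, hu, hv, hT u hu, hT v hv]
  have hfour : ({u, v, -u, -v} : Finset ℝ).card = 4 := by
    have h1 : u ≠ -v := fun h => hvu.2 (by linarith)
    have h2 : u ≠ -u := fun h => hu0 (by linarith)
    have h3 : v ≠ -v := fun h => hv0 (by linarith)
    have h4 : -u ≠ -v := fun h => hvu.1 (by linarith)
    rw [Finset.card_insert_of_notMem, Finset.card_insert_of_notMem, Finset.card_pair h4]
    · simp [hvu.2, h3]
    · simp [Ne.symm hvu.1, h1, h2]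
  intro t ht
  rw [← Finset.eq_of_subset_of_card_le hsub (by omega)] at ht
  simpa using ht

/-- Let `n = 3` or `n = 4` and let `A = {A_k; a_k}` be data for an `n`-th generalized
Riemann derivative without excess which is symmetric (the set of multipliers is symmetric
about `0`). Then there is a `q' ≠ 0, ±1` such that for all `f` and `x`: `D_A f(x)` exists
iff `_{q'}D^s_n f(x)` exists, and in that case the two are equal. -/
theorem symmetric_low_order_is_gaussian (n : ℕ) (hn : n = 3 ∨ n = 4)
    (A a : Fin (n + 1) → ℝ) (hA : ∀ k, A k ≠ 0) (ha : Function.Injective a)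
    (hsym : ∀ k, ∃ k', a k' = -a k)
    (hV : ∀ j ≤ n, ∑ k, A k * a k ^ j = if j = n then (Nat.factorial n : ℝ) else 0) :
    ∃ q' : ℝ, q' ≠ 0 ∧ q' ≠ 1 ∧ q' ≠ -1 ∧
      ∀ (f : ℝ → ℝ) (x : ℝ) (L : ℝ),
        Tendsto (fun h : ℝ => (∑ k, A k * f (x + a k * h)) / h ^ n)
            (𝓝[≠] (0 : ℝ)) (𝓝 L) ↔
          QSymGaussDerivAt q' n f x L := by
  set S : Finset ℝ := Finset.univ.image a with hS
  have hScard : S.card = n + 1 := by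
    rw [hS, Finset.card_image_of_injective _ ha, Finset.card_univ, Fintype.card_fin]
  have hSsym : ∀ t ∈ S.erase 0, -t ∈ S.erase 0 := by
    simp only [hS, Finset.mem_erase, Finset.mem_image, Finset.mem_univ, true_and]
    rintro t ⟨ht, k, rfl⟩
    exact ⟨neg_ne_zero.mpr ht, hsym k⟩
  have heven := even_card_of_symmetric hSsym (Finset.notMem_erase 0 S)
  have hmem : (0 : ℝ) ∈ S ↔ n = 4 := by
    by_cases h0 : (0 : ℝ) ∈ S
    · rw [Finset.card_erase_of_mem h0, hScard] at heven
      simp only [h0, true_iff]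
      rcases hn with rfl | rfl
      · exact absurd heven (by decide)
      · rfl
    · rw [Finset.erase_eq_of_notMem h0, hScard] at heven
      simp only [h0, false_iff]
      rintro rfl
      exact absurd heven (by decide)
  have hcard : (S.erase 0).card = 4 := by
    rcases hn with rfl | rfl
    · rw [Finset.erase_eq_of_notMem (by simp [hmem]), hScard]
    · rw [Finset.card_erase_of_mem (hmem.mpr rfl), hScard]
  obtain ⟨u, v, hu, hv, hvu, hvu', hpairs⟩ :=
    exists_pairs_of_symmetric hSsym (Finset.notMem_erase 0 S) hcard
  have haS : ∀ k, a k ∈ S := fun k => Finset.mem_image_of_mem a (Finset.mem_univ k)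
  refine ⟨v / u, div_ne_zero hv hu, fun h => hvu ((div_eq_one_iff_eq hu).mp h),
    fun h => hvu' (by rw [div_eq_iff hu] at h; linarith),
    tendsto_iff_qSymGaussDerivAt hu hA ha hV fun k => ?_⟩
  have hquv : u * (v / u) = v := mul_div_cancel₀ v hu
  rcases hn with rfl | rfl
  · have hk : a k ≠ 0 := fun h => by simpa using hmem.mp (h ▸ haS k)
    rcases hpairs (a k) (Finset.mem_erase.mpr ⟨hk, haS k⟩) with h | h | h | h
    · exact ⟨0, by simp [h, symGaussNodes]⟩
    · exact ⟨1, by simp [h, symGaussNodes, hquv]⟩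
    · exact ⟨2, by simp [h, symGaussNodes]⟩
    · exact ⟨3, by simp [h, symGaussNodes, hquv]⟩
  · by_cases hk : a k = 0
    · exact ⟨4, by simp [hk, symGaussNodes]⟩
    rcases hpairs (a k) (Finset.mem_erase.mpr ⟨hk, haS k⟩) with h | h | h | h
    · exact ⟨0, by simp [h, symGaussNodes]⟩
    · exact ⟨1, by simp [h, symGaussNodes, hquv]⟩
    · exact ⟨2, by simp [h, symGaussNodes]⟩
    · exact ⟨3, by simp [h, symGaussNodes, hquv]⟩
end
end
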